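/- Let ρ ∈ 𝕊^{μ}(ℝⁿ;𝒜_θ) for some μ ∈ ℝ, and suppose that the restriction (ρ(k))_{k∈ℤⁿ} belongs to the toroidal symbol class 𝕊^m(ℤⁿ;𝒜_θ) for some m ∈ ℝ. Then ρ ∈ 𝕊^m(ℝⁿ;𝒜_θ). -/

import Mathlib

open Complex Filter Topology
open scoped ComplexOrder Real BigOperators

noncomputable section

/-- Euclidean space `ℝⁿ`. -/
abbrev Rn (n : ℕ) : Type := EuclideanSpace ℝ (Fin n)

/-- `ℝⁿ × ℝⁿ`. -/
abbrev R2n (n : ℕ) : Type := Rn n × Rn n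

/-- Length `|β|` of a multi-order `β ∈ ℕ₀ⁿ`. -/
def mdeg {n : ℕ} (b : Fin n → ℕ) : ℕ := ∑ j, b j

/-- Composition of a list of self-maps. -/
def compList {X : Type*} (l : List (X → X)) : X → X := l.foldr (· ∘ ·) id

/-- The phase `c(k,l) = Σ_{q<p} k_p θ_{pq} l_q`. -/
def cPhase {n : ℕ} (θ : Matrix (Fin n) (Fin n) ℝ) (k l : Fin n → ℤ) : ℝ :=
  ∑ p, ∑ q, if q < p then (k p : ℝ) * θ p q * (l q : ℝ) else 0

/-- Euclidean norm `|k|` of a lattice point `k ∈ ℤⁿ`. -/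
def znorm {n : ℕ} (k : Fin n → ℤ) : ℝ := Real.sqrt (∑ j, ((k j : ℝ)) ^ 2)

/-- `k^β = ∏ k_jᵝ`. -/
def kpow {n : ℕ} (b : Fin n → ℕ) (k : Fin n → ℤ) : ℝ := ∏ j, ((k j : ℝ)) ^ (b j)

/-- A lattice point `k ∈ ℤⁿ` viewed as a point of `ℝⁿ`. -/
def zEmb {n : ℕ} (k : Fin n → ℤ) : Rn n := (WithLp.equiv 2 (Fin n → ℝ)).symm (fun j => (k j : ℝ))

variable {n : ℕ} {A : Type} [NormedRing A] [StarRing A] [CStarRing A]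
  [NormedAlgebra ℂ A] [StarModule ℂ A] [CompleteSpace A]

/-- The derivation `δ_j u = (1/i) ∂_{s_j} α_s(u)|_{s=0}`. -/
def δd (αa : Rn n → (A ≃⋆ₐ[ℂ] A)) (j : Fin n) (u : A) : A :=
  (-Complex.I) • fderiv ℝ (fun s : Rn n => αa s u) 0 (EuclideanSpace.single j 1)

/-- `δ^β = δ_1^{β_1} ⋯ δ_n^{β_n}`. -/
def δpow (αa : Rn n → (A ≃⋆ₐ[ℂ] A)) (b : Fin n → ℕ) : A → A :=
  compList (List.ofFn fun j => (δd αa j)^[b j])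

/-- The smooth noncommutative torus `𝒜_θ`: elements with `C^∞` orbit map. -/
def SmoothSet (αa : Rn n → (A ≃⋆ₐ[ℂ] A)) : Set A :=
  {u | ∀ N : ℕ, ContDiff ℝ N (fun s : Rn n => αa s u)}

/-- `A_θ^{(N)}`: elements with `C^N` orbit map. -/
def CNSet (αa : Rn n → (A ≃⋆ₐ[ℂ] A)) (N : ℕ) : Set A :=
  {u | ContDiff ℝ N (fun s : Rn n => αa s u)}

/-- The Fréchet seminorms `‖u‖_{(N)} = sup_{|β| ≤ N} ‖δ^β(u)‖` of `𝒜_θ`. -/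
def frSemi (αa : Rn n → (A ≃⋆ₐ[ℂ] A)) (N : ℕ) (u : A) : ℝ :=
  ⨆ b : {b : Fin n → ℕ // mdeg b ≤ N}, ‖δpow αa b.1 u‖

/-- Partial derivative `∂_{ξ_j}` of maps `ℝⁿ → A`. -/
def pd {n : ℕ} (j : Fin n) (f : Rn n → A) : Rn n → A :=
  fun ξ => fderiv ℝ f ξ (EuclideanSpace.single j 1)

/-- Iterated partial derivative `∂_ξ^β` of maps `ℝⁿ → A`. -/
def pdPow {n : ℕ} (b : Fin n → ℕ) : (Rn n → A) → (Rn n → A) :=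
  compList (List.ofFn fun j => (pd j)^[b j])

/-- Partial derivative `∂_{s_j}` (first variable) of maps `ℝⁿ×ℝⁿ → A`. -/
def pdS {n : ℕ} (j : Fin n) (f : R2n n → A) : R2n n → A :=
  fun x => fderiv ℝ f x (EuclideanSpace.single j 1, 0)

/-- Partial derivative `∂_{ξ_j}` (second variable) of maps `ℝⁿ×ℝⁿ → A`. -/
def pdXi {n : ℕ} (j : Fin n) (f : R2n n → A) : R2n n → A :=
  fun x => fderiv ℝ f x (0, EuclideanSpace.single j 1)

/-- `∂_s^β`. -/
def pdSPow {n : ℕ} (b : Fin n → ℕ) : (R2n n → A) → (R2n n → A) :=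
  compList (List.ofFn fun j => (pdS j)^[b j])

/-- `∂_ξ^γ`. -/
def pdXiPow {n : ℕ} (b : Fin n → ℕ) : (R2n n → A) → (R2n n → A) :=
  compList (List.ofFn fun j => (pdXi j)^[b j])

/-- Forward difference operator `Δ_j` on maps `ℝⁿ → A`. -/
def fdiff {n : ℕ} (j : Fin n) (f : Rn n → A) : Rn n → A :=
  fun ξ => f (ξ + EuclideanSpace.single j 1) - f ξ

/-- `Δ^β` on maps `ℝⁿ → A`. -/
def fdiffPow {n : ℕ} (b : Fin n → ℕ) : (Rn n → A) → (Rn n → A) :=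
  compList (List.ofFn fun j => (fdiff j)^[b j])

/-- Forward difference operator `Δ_j` on sequences `ℤⁿ → A`. -/
def zdiff {n : ℕ} (j : Fin n) (f : (Fin n → ℤ) → A) : (Fin n → ℤ) → A :=
  fun k => f (k + Pi.single j 1) - f k

/-- `Δ^β` on sequences `ℤⁿ → A`. -/
def zdiffPow {n : ℕ} (b : Fin n → ℕ) : ((Fin n → ℤ) → A) → ((Fin n → ℤ) → A) :=
  compList (List.ofFn fun j => (zdiff j)^[b j])

/-- The symbol class `𝕊^m(ℝⁿ; 𝒜_θ)`. -/
def IsSymbol (αa : Rn n → (A ≃⋆ₐ[ℂ] A)) (m : ℝ) (ρ : Rn n → A) : Prop :=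
  (∀ ξ, ρ ξ ∈ SmoothSet αa) ∧
  (∀ a : Fin n → ℕ, ∀ N : ℕ, ContDiff ℝ N fun ξ => δpow αa a (ρ ξ)) ∧
  (∀ a b : Fin n → ℕ, ∃ C > 0, ∀ ξ,
    ‖δpow αa a (pdPow b ρ ξ)‖ ≤ C * (1 + ‖ξ‖) ^ (m - (mdeg b : ℝ)))

/-- The class `𝒮(ℝⁿ; 𝒜_θ) = ∩ₘ 𝕊^m(ℝⁿ; 𝒜_θ)`. -/
def IsSchwartzSym (αa : Rn n → (A ≃⋆ₐ[ℂ] A)) (ρ : Rn n → A) : Prop :=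
  ∀ m : ℝ, IsSymbol αa m ρ

/-- The seminorm `p_N^{(m)}` on `𝕊^m(ℝⁿ; 𝒜_θ)`. -/
def pSemi (αa : Rn n → (A ≃⋆ₐ[ℂ] A)) (m : ℝ) (N : ℕ) (ρ : Rn n → A) : ℝ :=
  ⨆ q : {ab : (Fin n → ℕ) × (Fin n → ℕ) // mdeg ab.1 + mdeg ab.2 ≤ N} × Rn n,
    (1 + ‖q.2‖) ^ (-m + (mdeg q.1.1.2 : ℝ)) * ‖δpow αa q.1.1.1 (pdPow q.1.1.2 ρ q.2)‖

/-- The amplitude class `A^m(ℝⁿ×ℝⁿ; 𝒜_θ)`. -/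
def IsAmplitude (αa : Rn n → (A ≃⋆ₐ[ℂ] A)) (m : ℝ) (a : R2n n → A) : Prop :=
  (∀ x, a x ∈ SmoothSet αa) ∧
  (∀ c : Fin n → ℕ, ∀ N : ℕ, ContDiff ℝ N fun x => δpow αa c (a x)) ∧
  (∀ c b g : Fin n → ℕ, ∃ C > 0, ∀ x : R2n n,
    ‖δpow αa c (pdSPow b (pdXiPow g a) x)‖ ≤ C * (1 + ‖x.1‖ + ‖x.2‖) ^ m)

/-- The seminorm `q_N^{(m)}` on `A^m(ℝⁿ×ℝⁿ; 𝒜_θ)`. -/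
def qSemi (αa : Rn n → (A ≃⋆ₐ[ℂ] A)) (m : ℝ) (N : ℕ) (a : R2n n → A) : ℝ :=
  ⨆ q : {t : (Fin n → ℕ) × (Fin n → ℕ) × (Fin n → ℕ) //
      mdeg t.1 + mdeg t.2.1 + mdeg t.2.2 ≤ N} × R2n n,
    (1 + ‖q.2.1‖ + ‖q.2.2‖) ^ (-m) *
      ‖δpow αa q.1.1.1 (pdSPow q.1.1.2.1 (pdXiPow q.1.1.2.2 a) q.2)‖

/-- The toroidal symbol class `𝕊^m(ℤⁿ; 𝒜_θ)`. -/
def IsToroidal (αa : Rn n → (A ≃⋆ₐ[ℂ] A)) (m : ℝ) (ρ : (Fin n → ℤ) → A) : Prop :=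
  (∀ k, ρ k ∈ SmoothSet αa) ∧
  (∀ a b : Fin n → ℕ, ∃ C > 0, ∀ k,
    ‖δpow αa a (zdiffPow b ρ k)‖ ≤ C * (1 + znorm k) ^ (m - (mdeg b : ℝ)))

/-- The coefficient `(1-χ)/(|s|²+|ξ|²)` of the operator `L`. -/
def Lcoef {n : ℕ} (χc : R2n n → ℝ) (x : R2n n) : ℝ := (1 - χc x) / (‖x.1‖ ^ 2 + ‖x.2‖ ^ 2)

/-- The transpose `L^t` of `L = χ + (1-χ)(|s|²+|ξ|²)^{-1} Σ (ξ_j D_{s_j} + s_j D_{ξ_j})`,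
namely `L^t u = χ u - Σ_j (D_{s_j}((1-χ)(|s|²+|ξ|²)^{-1} ξ_j u) + D_{ξ_j}(… s_j u))`. -/
def Ltrans (χc : R2n n → ℝ) (u : R2n n → A) : R2n n → A := fun x =>
  χc x • u x -
    ∑ j, ((-Complex.I) • pdS j (fun y => (Lcoef χc y * y.2 j) • u y) x +
      (-Complex.I) • pdXi j (fun y => (Lcoef χc y * y.1 j) • u y) x)

/-- The (regularized) oscillating integral `(2π)^{-n} ∬ e^{is·ξ} (L^t)^N[a(s,ξ)] ds dξ`. -/
def Josc (χc : R2n n → ℝ) (N : ℕ) (a : R2n n → A) : A :=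
  ((2 * Real.pi) ^ n)⁻¹ •
    MeasureTheory.integral MeasureTheory.volume
      (fun x : R2n n => Complex.exp (Complex.I * ((∑ j, x.1 j * x.2 j : ℝ) : ℂ)) •
        ((Ltrans χc)^[N] a) x)

/-- A convenient integer `> m + 2n`. -/
def Nfor (n : ℕ) (m : ℝ) : ℕ := ⌈m⌉₊ + 2 * n + 1


open scoped ContDiff

section MultiIterate

/-- The iterate `T_1^{b_1} ⋯ T_n^{b_n}` of a family of self-maps. -/
def multiIter {n : ℕ} {X : Type*} (T : Fin n → X → X) (b : Fin n → ℕ) : X → X :=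
  compList (List.ofFn fun j => (T j)^[b j])

theorem multiIter_fin_succ {n : ℕ} {X : Type*} (T : Fin (n + 1) → X → X) (b : Fin (n + 1) → ℕ)
    (x : X) : multiIter T b x =
      (T 0)^[b 0] (multiIter (fun j => T j.succ) (fun j => b j.succ) x) := by
  simp [multiIter, compList, List.ofFn_succ]

theorem multiIter_zero {n : ℕ} {X : Type*} (T : Fin n → X → X) (x : X) :
    multiIter T 0 x = x := by
  induction n with
  | zero => simp [multiIter, compList]
  | succ n ih =>
    rw [multiIter_fin_succ]
    exact ih fun j => T j.succ

theorem iterate_mem {X : Type*} {S : Set X} {f : X → X} (hf : ∀ x ∈ S, f x ∈ S) (k : ℕ) {x : X}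
    (hx : x ∈ S) : f^[k] x ∈ S :=
  Set.MapsTo.iterate (s := S) (fun y hy => hf y hy) k hx

theorem iterate_intertwine {X Y : Type*} {S : Set X} {φ : X → Y} {f : X → X} {g : Y → Y}
    (hf : ∀ x ∈ S, f x ∈ S) (h : ∀ x ∈ S, φ (f x) = g (φ x)) (k : ℕ) {x : X} (hx : x ∈ S) :
    φ (f^[k] x) = g^[k] (φ x) := by
  induction k with
  | zero => rfl
  | succ k ih =>
    rw [Function.iterate_succ_apply', Function.iterate_succ_apply', h _ (iterate_mem hf k hx), ih]

theorem multiIter_mem {n : ℕ} {X : Type*} {S : Set X} {T : Fin n → X → X}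
    (hT : ∀ j, ∀ x ∈ S, T j x ∈ S) (b : Fin n → ℕ) {x : X} (hx : x ∈ S) :
    multiIter T b x ∈ S := by
  induction n with
  | zero => simpa [multiIter, compList] using hx
  | succ n ih =>
    rw [multiIter_fin_succ]
    exact iterate_mem (hT 0) _ (ih (fun j => hT j.succ) _)

theorem multiIter_intertwine {n : ℕ} {X Y : Type*} {S : Set X} {φ : X → Y} {T : Fin n → X → X}
    {U : Fin n → Y → Y} (hT : ∀ j, ∀ x ∈ S, T j x ∈ S)
    (h : ∀ j, ∀ x ∈ S, φ (T j x) = U j (φ x)) (b : Fin n → ℕ) {x : X} (hx : x ∈ S) :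
    φ (multiIter T b x) = multiIter U b (φ x) := by
  induction n with
  | zero => simp [multiIter, compList]
  | succ n ih =>
    rw [multiIter_fin_succ, multiIter_fin_succ, iterate_intertwine (hT 0) (h 0) _
      (multiIter_mem (fun j => hT j.succ) _ hx), ih (fun j => hT j.succ) fun j => h j.succ]

theorem apply_multiIter {n : ℕ} {X : Type*} {S : Set X} {T : Fin n → X → X}
    (hT : ∀ j, ∀ x ∈ S, T j x ∈ S) (hc : ∀ i j, ∀ x ∈ S, T i (T j x) = T j (T i x))
    (b : Fin n → ℕ) (i : Fin n) {x : X} (hx : x ∈ S) :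
    T i (multiIter T b x) = multiIter T (b + Pi.single i 1) x := by
  induction n with
  | zero => exact i.elim0
  | succ n ih =>
    rw [multiIter_fin_succ, multiIter_fin_succ]
    have hm : ∀ c, multiIter (fun j : Fin n => T j.succ) c x ∈ S := fun c =>
      multiIter_mem (fun j => hT j.succ) c hx
    refine Fin.cases ?_ (fun k => ?_) i
    · simp [Function.iterate_succ_apply']
    · rw [iterate_intertwine (hT 0) (fun y hy => hc _ 0 y hy) _ (hm _),
        ih (T := fun j => T j.succ) (fun j => hT j.succ) (fun p q => hc p.succ q.succ)]
      simp only [Pi.add_apply, Pi.single_apply]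
      congr 2
      simp only [Fin.succ_inj]
      congr 1
      ext j
      simp [Pi.single_apply]

theorem multiIter_add_single {n : ℕ} {X : Type*} {S : Set X} {T : Fin n → X → X}
    (hT : ∀ j, ∀ x ∈ S, T j x ∈ S) (hc : ∀ i j, ∀ x ∈ S, T i (T j x) = T j (T i x))
    (b : Fin n → ℕ) (i : Fin n) {x : X} (hx : x ∈ S) :
    multiIter T (b + Pi.single i 1) x = multiIter T b (T i x) := by
  rw [← apply_multiIter hT hc b i hx, multiIter_intertwine hT (fun j y hy => hc i j y hy) b hx]

theorem mdeg_add_single {n : ℕ} (b : Fin n → ℕ) (i : Fin n) :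
    mdeg (b + Pi.single i 1) = mdeg b + 1 := by
  simp [mdeg, Finset.sum_add_distrib]

theorem multiOrder_induction {n : ℕ} {P : (Fin n → ℕ) → Prop} (zero : P 0)
    (add_single : ∀ b i, P b → P (b + Pi.single i 1)) (b : Fin n → ℕ) : P b := by
  induction hd : mdeg b generalizing b with
  | zero =>
    have : b = 0 := by
      ext j
      simpa using (Finset.sum_eq_zero_iff.1 hd) j (Finset.mem_univ j)
    rwa [this]
  | succ d ih =>
    obtain ⟨i, hi⟩ : ∃ i, b i ≠ 0 := by
      by_contra! h
      simp [mdeg, h] at hd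
    have hb : b = (b - Pi.single i 1) + Pi.single i 1 := by
      ext j
      rcases eq_or_ne j i with rfl | hj
      · simp only [Pi.add_apply, Pi.sub_apply, Pi.single_eq_same]; omega
      · simp [hj]
    rw [hb] at hd ⊢
    rw [mdeg_add_single] at hd
    exact add_single _ _ (ih _ (by omega))

end MultiIterate

section PartialDerivatives

variable {B : Type} [NormedRing B] [NormedAlgebra ℂ B]

theorem contDiff_pd {f : Rn n → B} (hf : ContDiff ℝ ∞ f) (j : Fin n) : ContDiff ℝ ∞ (pd j f) :=
  (contDiff_infty_iff_fderiv.1 hf).2.clm_apply contDiff_const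

theorem pd_comm {f : Rn n → B} (hf : ContDiff ℝ ∞ f) (i j : Fin n) :
    pd i (pd j f) = pd j (pd i f) := by
  have hd : Differentiable ℝ (fderiv ℝ f) :=
    (contDiff_infty_iff_fderiv.1 hf).2.differentiable (by simp)
  have key : ∀ i j : Fin n, ∀ ξ, pd i (pd j f) ξ =
      fderiv ℝ (fderiv ℝ f) ξ (EuclideanSpace.single i 1) (EuclideanSpace.single j 1) := by
    intro i j ξ
    unfold pd
    rw [fderiv_clm_apply (hd ξ) (differentiableAt_const _)]
    simp
  ext1 ξ
  rw [key, key]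
  exact ((contDiff_infty.1 hf 2).contDiffAt.isSymmSndFDerivAt (by simp)) _ _

theorem contDiff_pdPow {f : Rn n → B} (hf : ContDiff ℝ ∞ f) (b : Fin n → ℕ) :
    ContDiff ℝ ∞ (pdPow b f) :=
  multiIter_mem (S := {f : Rn n → B | ContDiff ℝ ∞ f}) (fun j _ h => contDiff_pd h j) b hf

theorem pdPow_zero (f : Rn n → B) : pdPow 0 f = f := multiIter_zero _ f

theorem pd_pdPow {f : Rn n → B} (hf : ContDiff ℝ ∞ f) (b : Fin n → ℕ) (i : Fin n) :
    pd i (pdPow b f) = pdPow (b + Pi.single i 1) f :=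
  apply_multiIter (S := {f : Rn n → B | ContDiff ℝ ∞ f}) (fun j _ h => contDiff_pd h j)
    (fun i j _ h => pd_comm h i j) b i hf

theorem pdPow_add_single {f : Rn n → B} (hf : ContDiff ℝ ∞ f) (b : Fin n → ℕ) (i : Fin n) :
    pdPow (b + Pi.single i 1) f = pdPow b (pd i f) :=
  multiIter_add_single (S := {f : Rn n → B | ContDiff ℝ ∞ f}) (fun j _ h => contDiff_pd h j)
    (fun i j _ h => pd_comm h i j) b i hf

theorem contDiff_fdiff {f : Rn n → B} (hf : ContDiff ℝ ∞ f) (i : Fin n) :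
    ContDiff ℝ ∞ (fdiff i f) :=
  (hf.comp (contDiff_id.add contDiff_const)).sub hf

theorem pd_fdiff {f : Rn n → B} (hf : ContDiff ℝ ∞ f) (i j : Fin n) :
    pd j (fdiff i f) = fdiff i (pd j f) := by
  have hd : Differentiable ℝ f := hf.differentiable (by simp)
  ext1 ξ
  have hs : DifferentiableAt ℝ (fun η => f (η + EuclideanSpace.single i 1)) ξ :=
    (hd _).comp ξ (by fun_prop)
  simp only [pd]
  unfold fdiff
  rw [fderiv_fun_sub hs (hd ξ), fderiv_comp_add_right]
  rfl

theorem pd_sub {f g : Rn n → B} (hf : ContDiff ℝ ∞ f) (hg : ContDiff ℝ ∞ g) (j : Fin n) :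
    pd j (f - g) = pd j f - pd j g := by
  ext1 ξ
  simp only [pd, Pi.sub_apply]
  rw [fderiv_sub (hf.differentiable (by simp) ξ) (hg.differentiable (by simp) ξ)]
  rfl

theorem pd_smul (c : ℂ) {f : Rn n → B} (hf : ContDiff ℝ ∞ f) (j : Fin n) :
    pd j (c • f) = c • pd j f := by
  ext1 ξ
  simp only [pd, Pi.smul_apply]
  rw [fderiv_const_smul (hf.differentiable (by simp) ξ)]
  rfl

theorem fderiv_eq_sum_pd (f : Rn n → B) (ξ : Rn n) :
    fderiv ℝ f ξ = ∑ j, (EuclideanSpace.proj j : Rn n →L[ℝ] ℝ).smulRight (pd j f ξ) := by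
  ext v
  conv_lhs => rw [← (EuclideanSpace.basisFun (Fin n) ℝ).sum_repr v]
  simp [pd]

theorem norm_sum_proj_smulRight_le (v : Fin n → B) :
    ‖∑ j, (EuclideanSpace.proj j : Rn n →L[ℝ] ℝ).smulRight (v j)‖ ≤ ∑ j, ‖v j‖ := by
  refine (norm_sum_le _ _).trans (Finset.sum_le_sum fun j _ => ?_)
  refine ContinuousLinearMap.opNorm_le_bound _ (norm_nonneg _) fun x => ?_
  simp only [ContinuousLinearMap.smulRight_apply, norm_smul, PiLp.proj_apply]
  rw [mul_comm]
  gcongr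
  exact PiLp.norm_apply_le x j

end PartialDerivatives

section Orbits

variable {B : Type} [NormedRing B] [StarRing B] [NormedAlgebra ℂ B]

theorem mem_smoothSet_iff {αa : Rn n → (B ≃⋆ₐ[ℂ] B)} {u : B} :
    u ∈ SmoothSet αa ↔ ContDiff ℝ ∞ fun s => αa s u :=
  contDiff_infty.symm

theorem map_real_smul_starAlgEquiv (e : B ≃⋆ₐ[ℂ] B) (c : ℝ) (u : B) : e (c • u) = c • e u := by
  rw [← Complex.coe_smul, ← Complex.coe_smul, map_smul]

/-- B norm-preserving `*`-automorphism as a continuous real-linear map. -/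
def isometricCLM (e : B ≃⋆ₐ[ℂ] B) (he : ∀ u, ‖e u‖ = ‖u‖) : B →L[ℝ] B :=
  LinearMap.mkContinuous
    { toFun := e, map_add' := map_add e, map_smul' := map_real_smul_starAlgEquiv e } 1
    fun u => by simp [he]

@[simp]
theorem isometricCLM_apply (e : B ≃⋆ₐ[ℂ] B) (he : ∀ u, ‖e u‖ = ‖u‖) (u : B) :
    isometricCLM e he u = e u := rfl

theorem δd_eq_pd (αa : Rn n → (B ≃⋆ₐ[ℂ] B)) (j : Fin n) (u : B) :
    δd αa j u = (-Complex.I) • pd j (fun s => αa s u) 0 := rfl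

theorem I_smul_δd (αa : Rn n → (B ≃⋆ₐ[ℂ] B)) (j : Fin n) (u : B) :
    Complex.I • δd αa j u = pd j (fun s => αa s u) 0 := by
  rw [δd_eq_pd, smul_smul]
  simp

theorem sub_mem_smoothSet {αa : Rn n → (B ≃⋆ₐ[ℂ] B)} {u v : B} (hu : u ∈ SmoothSet αa)
    (hv : v ∈ SmoothSet αa) : u - v ∈ SmoothSet αa := by
  rw [mem_smoothSet_iff] at *
  simpa only [map_sub] using hu.sub hv

theorem real_smul_mem_smoothSet {αa : Rn n → (B ≃⋆ₐ[ℂ] B)} (c : ℝ) {u : B}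
    (hu : u ∈ SmoothSet αa) : c • u ∈ SmoothSet αa := by
  rw [mem_smoothSet_iff] at *
  simpa only [map_real_smul_starAlgEquiv] using hu.const_smul c

theorem δd_sub {αa : Rn n → (B ≃⋆ₐ[ℂ] B)} {u v : B} (hu : u ∈ SmoothSet αa)
    (hv : v ∈ SmoothSet αa) (j : Fin n) : δd αa j (u - v) = δd αa j u - δd αa j v := by
  rw [mem_smoothSet_iff] at *
  have h : (fun s => αa s (u - v)) = (fun s => αa s u) - fun s => αa s v := by
    ext s; simp
  simp only [δd_eq_pd, h, pd_sub hu hv, Pi.sub_apply, smul_sub]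

theorem δd_real_smul {αa : Rn n → (B ≃⋆ₐ[ℂ] B)} (c : ℝ) {u : B} (hu : u ∈ SmoothSet αa)
    (j : Fin n) : δd αa j (c • u) = c • δd αa j u := by
  rw [mem_smoothSet_iff] at *
  have h : (fun s => αa s (c • u)) = (c : ℂ) • fun s => αa s u := by
    ext s; simp [map_real_smul_starAlgEquiv]
  rw [δd_eq_pd, δd_eq_pd, h, pd_smul _ hu, Pi.smul_apply, smul_comm, Complex.coe_smul]

variable {αa : Rn n → (B ≃⋆ₐ[ℂ] B)}

theorem hasFDerivAt_orbit (hαadd : ∀ s t (u : B), αa (s + t) u = αa s (αa t u))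
    (hαiso : ∀ s (u : B), ‖αa s u‖ = ‖u‖) {u : B} (hu : u ∈ SmoothSet αa) (s : Rn n) :
    HasFDerivAt (fun t => αa t u)
      (∑ j, (EuclideanSpace.proj j : Rn n →L[ℝ] ℝ).smulRight (αa s (Complex.I • δd αa j u))) s := by
  rw [mem_smoothSet_iff] at hu
  have h0 := (hu.differentiable (by simp) 0).hasFDerivAt
  rw [fderiv_eq_sum_pd] at h0
  have h1 : (fun t => αa t u) = fun t => isometricCLM (αa s) (hαiso s) (αa (t - s) u) := by
    ext t
    rw [isometricCLM_apply, ← hαadd, add_sub_cancel]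
  rw [← sub_self s] at h0
  have h2 := (isometricCLM (αa s) (hαiso s)).hasFDerivAt.comp s
    (HasFDerivAt.comp s (f := fun t => t - s) h0 ((hasFDerivAt_id s).sub_const s))
  rw [h1]
  refine h2.congr_fderiv ?_
  ext v
  simp only [sub_self]
  simp [I_smul_δd]

theorem pd_orbit (hαadd : ∀ s t (u : B), αa (s + t) u = αa s (αa t u))
    (hαiso : ∀ s (u : B), ‖αa s u‖ = ‖u‖) {u : B} (hu : u ∈ SmoothSet αa) (j : Fin n) :
    pd j (fun s => αa s u) = fun s => αa s (Complex.I • δd αa j u) := by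
  ext s
  simp only [pd]
  rw [(hasFDerivAt_orbit hαadd hαiso hu s).fderiv]
  simp

theorem orbit_δd (hαadd : ∀ s t (u : B), αa (s + t) u = αa s (αa t u))
    (hαiso : ∀ s (u : B), ‖αa s u‖ = ‖u‖) {u : B} (hu : u ∈ SmoothSet αa) (j : Fin n) :
    (fun s => αa s (δd αa j u)) = (-Complex.I) • pd j (fun s => αa s u) := by
  ext s
  simp [pd_orbit hαadd hαiso hu j, smul_smul]

theorem δd_mem_smoothSet (hαadd : ∀ s t (u : B), αa (s + t) u = αa s (αa t u))
    (hαiso : ∀ s (u : B), ‖αa s u‖ = ‖u‖) (j : Fin n) {u : B} (hu : u ∈ SmoothSet αa) :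
    δd αa j u ∈ SmoothSet αa := by
  rw [mem_smoothSet_iff, orbit_δd hαadd hαiso hu]
  exact (contDiff_pd (mem_smoothSet_iff.1 hu) j).const_smul (-Complex.I)

theorem δd_comm (hαadd : ∀ s t (u : B), αa (s + t) u = αa s (αa t u))
    (hαiso : ∀ s (u : B), ‖αa s u‖ = ‖u‖) (i j : Fin n) {u : B} (hu : u ∈ SmoothSet αa) :
    δd αa i (δd αa j u) = δd αa j (δd αa i u) := by
  have h := mem_smoothSet_iff.1 hu
  rw [δd_eq_pd αa i, orbit_δd hαadd hαiso hu, δd_eq_pd αa j, orbit_δd hαadd hαiso hu,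
    pd_smul (-Complex.I) (contDiff_pd h j), pd_smul (-Complex.I) (contDiff_pd h i), pd_comm h]

theorem δpow_zero (u : B) : δpow αa 0 u = u := multiIter_zero _ u

theorem δpow_mem_smoothSet (hαadd : ∀ s t (u : B), αa (s + t) u = αa s (αa t u))
    (hαiso : ∀ s (u : B), ‖αa s u‖ = ‖u‖) (a : Fin n → ℕ) {u : B} (hu : u ∈ SmoothSet αa) :
    δpow αa a u ∈ SmoothSet αa :=
  multiIter_mem (fun j _ h => δd_mem_smoothSet hαadd hαiso j h) a hu

theorem δd_δpow (hαadd : ∀ s t (u : B), αa (s + t) u = αa s (αa t u))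
    (hαiso : ∀ s (u : B), ‖αa s u‖ = ‖u‖) (a : Fin n → ℕ) (i : Fin n) {u : B}
    (hu : u ∈ SmoothSet αa) : δd αa i (δpow αa a u) = δpow αa (a + Pi.single i 1) u :=
  apply_multiIter (S := SmoothSet αa) (fun j _ h => δd_mem_smoothSet hαadd hαiso j h)
    (fun i j _ h => δd_comm hαadd hαiso i j h) a i hu

theorem δpow_smul_sub (hαadd : ∀ s t (u : B), αa (s + t) u = αa s (αa t u))
    (hαiso : ∀ s (u : B), ‖αa s u‖ = ‖u‖) (a : Fin n → ℕ) (c : ℝ) {u v : B}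
    (hu : u ∈ SmoothSet αa) (hv : v ∈ SmoothSet αa) :
    δpow αa a (c • (u - v)) = c • (δpow αa a u - δpow αa a v) := by
  induction a using multiOrder_induction with
  | zero => simp [δpow_zero]
  | add_single a i ih =>
    have hs := sub_mem_smoothSet hu hv
    have hm := fun {w : B} (hw : w ∈ SmoothSet αa) => δpow_mem_smoothSet hαadd hαiso a hw
    rw [← δd_δpow hαadd hαiso a i (real_smul_mem_smoothSet c hs), ih,
      δd_real_smul c (sub_mem_smoothSet (hm hu) (hm hv)), δd_sub (hm hu) (hm hv),
      δd_δpow hαadd hαiso a i hu, δd_δpow hαadd hαiso a i hv]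

/-- Completeness of the smooth algebra: if all `δ^a (u h)` converge in norm, the limit of `u h`
is smooth and its derivatives are the limits of the derivatives. -/
theorem smoothSet_limit (hαadd : ∀ s t (u : B), αa (s + t) u = αa s (αa t u))
    (hα0 : ∀ u : B, αa 0 u = u)
    (hαiso : ∀ s (u : B), ‖αa s u‖ = ‖u‖) {ι : Type*} {l : Filter ι} [l.NeBot] {u : ι → B}
    (hu : ∀ h, u h ∈ SmoothSet αa) {w : (Fin n → ℕ) → B}
    (hw : ∀ a, Tendsto (fun h => δpow αa a (u h)) l (𝓝 (w a))) :
    w 0 ∈ SmoothSet αa ∧ ∀ a, δpow αa a (w 0) = w a := by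
  have hder : ∀ a s, HasFDerivAt (fun t => αa t (w a))
      (∑ j, (EuclideanSpace.proj j : Rn n →L[ℝ] ℝ).smulRight
        (αa s (Complex.I • w (a + Pi.single j 1)))) s := by
    intro a
    refine hasFDerivAt_of_tendstoUniformly (l := l) (f := fun h t => αa t (δpow αa a (u h)))
      (f' := fun h s => ∑ j, (EuclideanSpace.proj j : Rn n →L[ℝ] ℝ).smulRight
        (αa s (Complex.I • δpow αa (a + Pi.single j 1) (u h)))) ?_ ?_ ?_
    · rw [Metric.tendstoUniformly_iff]
      intro ε hε
      have hlim : Tendsto (fun h => ∑ j : Fin n, ‖w (a + Pi.single j 1) -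
          δpow αa (a + Pi.single j 1) (u h)‖) l (𝓝 0) := by
        have := tendsto_finsetSum (Finset.univ : Finset (Fin n)) fun j _ =>
          ((tendsto_const_nhds (x := w (a + Pi.single j 1))).sub (hw (a + Pi.single j 1))).norm
        simpa using this
      filter_upwards [hlim.eventually (gt_mem_nhds hε)] with h hh s
      refine lt_of_le_of_lt ?_ hh
      rw [dist_eq_norm, ← Finset.sum_sub_distrib]
      have : ∀ j : Fin n, (EuclideanSpace.proj j : Rn n →L[ℝ] ℝ).smulRight
          (αa s (Complex.I • w (a + Pi.single j 1))) -
          (EuclideanSpace.proj j : Rn n →L[ℝ] ℝ).smulRight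
            (αa s (Complex.I • δpow αa (a + Pi.single j 1) (u h))) =
          (EuclideanSpace.proj j : Rn n →L[ℝ] ℝ).smulRight
            (αa s (Complex.I • (w (a + Pi.single j 1) - δpow αa (a + Pi.single j 1) (u h)))) := by
        intro j
        ext v
        simp [smul_sub]
      simp only [this]
      refine (norm_sum_proj_smulRight_le _).trans (le_of_eq ?_)
      simp only [hαiso, norm_smul, Complex.norm_I, one_mul]
    · intro h s
      have := hasFDerivAt_orbit hαadd hαiso (δpow_mem_smoothSet hαadd hαiso a (hu h)) s
      simpa only [δd_δpow hαadd hαiso a _ (hu h)] using this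
    · intro s
      exact ((isometricCLM (αa s) (hαiso s)).continuous.tendsto _).comp (hw a)
  have hsm : ∀ a, w a ∈ SmoothSet αa := by
    suffices H : ∀ N : ℕ, ∀ a, ContDiff ℝ N fun s => αa s (w a) from fun a N => H N a
    intro N
    induction N with
    | zero =>
      intro a
      have : Differentiable ℝ fun s => αa s (w a) := fun s => (hder a s).differentiableAt
      simpa using this.continuous
    | succ N ih =>
      intro a
      refine contDiff_succ_iff_hasFDerivAt.2 ⟨_, ?_, hder a⟩
      refine ContDiff.sum fun j _ => ?_
      refine contDiff_const.smulRight ?_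
      simp only [map_smul]
      exact (ih _).const_smul _
  have hδ : ∀ a j, δd αa j (w a) = w (a + Pi.single j 1) := by
    intro a j
    unfold δd
    rw [(hder a 0).fderiv]
    simp [hα0, smul_smul]
  refine ⟨hsm 0, fun a => ?_⟩
  induction a using multiOrder_induction with
  | zero => exact δpow_zero _
  | add_single a i ih => rw [← δd_δpow hαadd hαiso a i (hsm 0), ih, hδ]

theorem pdPow_mem_smoothSet_and_δpow_pdPow
    (hαadd : ∀ s t (u : B), αa (s + t) u = αa s (αa t u)) (hα0 : ∀ u : B, αa 0 u = u)
    (hαiso : ∀ s (u : B), ‖αa s u‖ = ‖u‖) {ρ : Rn n → B} (hρ : ∀ ξ, ρ ξ ∈ SmoothSet αa)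
    (hρδ : ∀ a, ContDiff ℝ ∞ fun ξ => δpow αa a (ρ ξ)) (b : Fin n → ℕ) :
    (∀ ξ, pdPow b ρ ξ ∈ SmoothSet αa) ∧
      ∀ a ξ, δpow αa a (pdPow b ρ ξ) = pdPow b (fun η => δpow αa a (ρ η)) ξ := by
  have hρ0 : ContDiff ℝ ∞ ρ := by simpa only [δpow_zero] using hρδ 0
  induction b using multiOrder_induction with
  | zero => simpa [pdPow_zero] using hρ
  | add_single b i ih =>
    obtain ⟨ihm, ihδ⟩ := ih
    have hw0 : ∀ ξ, pdPow (b + Pi.single i 1) (fun η => δpow αa 0 (ρ η)) ξ =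
        pdPow (b + Pi.single i 1) ρ ξ := fun ξ => by simp only [δpow_zero]
    have key := fun ξ => smoothSet_limit hαadd hα0 hαiso (l := 𝓝[≠] (0 : ℝ))
      (u := fun h => h⁻¹ • (pdPow b ρ (ξ + h • EuclideanSpace.single i 1) - pdPow b ρ ξ))
      (fun h => real_smul_mem_smoothSet _ (sub_mem_smoothSet (ihm _) (ihm _)))
      (w := fun a => pdPow (b + Pi.single i 1) (fun η => δpow αa a (ρ η)) ξ) (fun a => by
        simp only [δpow_smul_sub hαadd hαiso a _ (ihm _) (ihm _), ihδ, ← pd_pdPow (hρδ a)]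
        exact (((contDiff_pdPow (hρδ a) b).differentiable (by simp)
          ξ).hasFDerivAt.hasLineDerivAt _).tendsto_slope_zero)
    simp only [hw0] at key
    exact ⟨fun ξ => (key ξ).1, fun a ξ => (key ξ).2 a⟩

theorem δpow_zdiffPow (hαadd : ∀ s t (u : B), αa (s + t) u = αa s (αa t u))
    (hαiso : ∀ s (u : B), ‖αa s u‖ = ‖u‖) {r : (Fin n → ℤ) → B} (hr : ∀ k, r k ∈ SmoothSet αa)
    (a b : Fin n → ℕ) (k : Fin n → ℤ) :
    δpow αa a (zdiffPow b r k) = zdiffPow b (fun p => δpow αa a (r p)) k := by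
  refine congrFun (multiIter_intertwine (S := {r : (Fin n → ℤ) → B | ∀ k, r k ∈ SmoothSet αa})
    (φ := fun r p => δpow αa a (r p)) (T := zdiff) (U := zdiff)
    (fun j x hx p => sub_mem_smoothSet (hx _) (hx _)) (fun j x hx => ?_) b hr) k
  ext1 p
  simpa [zdiff] using δpow_smul_sub hαadd hαiso a 1 (hx (p + Pi.single j 1)) (hx p)

end Orbits

section SymbolBounds

open Asymptotics

variable {B : Type} [NormedRing B] [NormedAlgebra ℂ B]

/-- The weight `(1 + |ξ|)^ν`. -/
def weight {n : ℕ} (ν : ℝ) (ξ : Rn n) : ℝ := (1 + ‖ξ‖) ^ ν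

theorem weight_pos (ν : ℝ) (ξ : Rn n) : 0 < weight ν ξ :=
  Real.rpow_pos_of_pos (by positivity) _

theorem norm_weight (ν : ℝ) (ξ : Rn n) : ‖weight ν ξ‖ = weight ν ξ :=
  Real.norm_of_nonneg (weight_pos ν ξ).le

omit [NormedAlgebra ℂ B] in
theorem isBigO_top_weight_iff {ν : ℝ} {g : Rn n → B} :
    g =O[⊤] weight ν ↔ ∃ C > 0, ∀ ξ, ‖g ξ‖ ≤ C * (1 + ‖ξ‖) ^ ν := by
  simp only [isBigO_iff', eventually_top, norm_weight]
  rfl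

theorem weight_isBigO_weight {ν ν' : ℝ} (h : ν ≤ ν') :
    (weight ν : Rn n → ℝ) =O[⊤] (weight ν' : Rn n → ℝ) := by
  refine isBigO_top.2 ⟨1, fun ξ => ?_⟩
  rw [norm_weight, norm_weight, one_mul]
  exact Real.rpow_le_rpow_of_exponent_le (by simp) h

/-- Peetre's inequality. -/
theorem weight_le_of_norm_sub_le {ξ η : Rn n} {R : ℝ} (h : ‖ξ - η‖ ≤ R) (ν : ℝ) :
    weight ν ξ ≤ (1 + R) ^ |ν| * weight ν η := by
  have hR : 0 ≤ R := (norm_nonneg _).trans h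
  have hcomp : ∀ {x y : Rn n}, ‖x - y‖ ≤ R → 1 + ‖x‖ ≤ (1 + R) * (1 + ‖y‖) := by
    intro x y hxy
    have := norm_le_norm_add_norm_sub' x y
    nlinarith [mul_nonneg hR (norm_nonneg y)]
  unfold weight
  rcases le_total 0 ν with hν | hν
  · rw [abs_of_nonneg hν, ← Real.mul_rpow (by positivity) (by positivity)]
    exact Real.rpow_le_rpow (by positivity) (hcomp h) hν
  · have hyx := Real.rpow_le_rpow_of_nonpos (by positivity)
      (hcomp (x := η) (y := ξ) (by rwa [norm_sub_rev])) hν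
    rw [Real.mul_rpow (by positivity) (by positivity)] at hyx
    calc (1 + ‖ξ‖) ^ ν = (1 + R) ^ |ν| * ((1 + R) ^ ν * (1 + ‖ξ‖) ^ ν) := by
          rw [← mul_assoc, ← Real.rpow_add (by positivity), abs_of_nonpos hν, neg_add_cancel,
            Real.rpow_zero, one_mul]
      _ ≤ _ := by gcongr

theorem exists_norm_sub_le_weight {h : Rn n → B} (hh : ContDiff ℝ ∞ h) {ν : ℝ}
    (hpd : ∀ j, pd j h =O[⊤] weight ν) (R : ℝ) :
    ∃ C, ∀ ξ η : Rn n, ‖η - ξ‖ ≤ R → ‖h η - h ξ‖ ≤ C * weight ν ξ := by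
  simp only [isBigO_top, norm_weight] at hpd
  choose c hc using hpd
  refine ⟨(∑ j, |c j|) * (1 + R) ^ |ν| * R, fun ξ η hη => ?_⟩
  have hR : 0 ≤ R := (norm_nonneg _).trans hη
  have hbound : ∀ x ∈ Metric.closedBall ξ R,
      ‖fderiv ℝ h x‖ ≤ (∑ j, |c j|) * ((1 + R) ^ |ν| * weight ν ξ) := by
    intro x hx
    rw [mem_closedBall_iff_norm] at hx
    rw [fderiv_eq_sum_pd]
    refine (norm_sum_proj_smulRight_le _).trans ?_
    rw [Finset.sum_mul]
    refine Finset.sum_le_sum fun j _ => (hc j x).trans ?_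
    exact mul_le_mul (le_abs_self _) (weight_le_of_norm_sub_le hx ν) (weight_pos _ _).le
      (abs_nonneg _)
  refine (Convex.norm_image_sub_le_of_norm_fderiv_le
    (fun x _ => hh.differentiable (by simp) x) hbound (convex_closedBall ξ R)
    (Metric.mem_closedBall_self hR) (mem_closedBall_iff_norm.2 hη)).trans ?_
  have := weight_pos ν ξ
  calc _ ≤ (∑ j, |c j|) * ((1 + R) ^ |ν| * weight ν ξ) * R := by gcongr
    _ = _ := by ring

theorem fdiff_isBigO_weight {h : Rn n → B} (hh : ContDiff ℝ ∞ h) {ν : ℝ}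
    (hpd : ∀ j, pd j h =O[⊤] weight ν) (i : Fin n) : fdiff i h =O[⊤] weight ν := by
  obtain ⟨C, hC⟩ := exists_norm_sub_le_weight hh hpd 1
  refine isBigO_top.2 ⟨C, fun ξ => ?_⟩
  rw [norm_weight]
  exact hC _ _ (by simp)

theorem fdiff_sub_pd_isBigO_weight {h : Rn n → B} (hh : ContDiff ℝ ∞ h) {ν : ℝ}
    (hpd : ∀ i j, pd i (pd j h) =O[⊤] weight ν) (i : Fin n) :
    (fdiff i h - pd i h) =O[⊤] weight ν := by
  choose C hC using fun j => exists_norm_sub_le_weight (contDiff_pd hh j) (fun i => hpd i j) 1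
  refine isBigO_top.2 ⟨∑ j, C j, fun ξ => ?_⟩
  rw [norm_weight]
  have hbound : ∀ x ∈ Metric.closedBall ξ 1,
      ‖fderiv ℝ h x - fderiv ℝ h ξ‖ ≤ (∑ j, C j) * weight ν ξ := by
    intro x hx
    rw [mem_closedBall_iff_norm] at hx
    rw [fderiv_eq_sum_pd h x, fderiv_eq_sum_pd h ξ, ← Finset.sum_sub_distrib, Finset.sum_mul]
    have : ∀ j : Fin n, (EuclideanSpace.proj j : Rn n →L[ℝ] ℝ).smulRight (pd j h x) -
        (EuclideanSpace.proj j : Rn n →L[ℝ] ℝ).smulRight (pd j h ξ) =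
        (EuclideanSpace.proj j : Rn n →L[ℝ] ℝ).smulRight (pd j h x - pd j h ξ) := by
      intro j
      ext v
      simp [smul_sub]
    simp only [this]
    exact (norm_sum_proj_smulRight_le _).trans (Finset.sum_le_sum fun j _ => hC j ξ x hx)
  have := Convex.norm_image_sub_le_of_norm_fderiv_le' (φ := fderiv ℝ h ξ)
    (y := ξ + EuclideanSpace.single i (1 : ℝ))
    (fun x _ => hh.differentiable (by simp) x) hbound (convex_closedBall ξ 1)
    (Metric.mem_closedBall_self zero_le_one) (by simp)
  simpa [fdiff, pd] using this

/-- The bounds `∂^b f = O((1 + |ξ|)^{μ - |b|})` for all multi-orders `b`. -/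
def SymbolBounds {n : ℕ} (μ : ℝ) (f : Rn n → B) : Prop :=
  ∀ b : Fin n → ℕ, pdPow b f =O[⊤] weight (μ - mdeg b)

theorem SymbolBounds.mono {μ μ' : ℝ} {f : Rn n → B} (h : SymbolBounds μ f) (hμ : μ ≤ μ') :
    SymbolBounds μ' f := fun b =>
  (h b).trans (weight_isBigO_weight (by linarith))

theorem SymbolBounds.pd_pdPow {μ : ℝ} {f : Rn n → B} (h : SymbolBounds μ f)
    (hf : ContDiff ℝ ∞ f) (b : Fin n → ℕ) (i : Fin n) :
    pd i (pdPow b f) =O[⊤] weight (μ - mdeg b - 1) := by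
  have := h (b + Pi.single i 1)
  rwa [← _root_.pd_pdPow hf, mdeg_add_single, Nat.cast_add_one, ← sub_sub] at this

theorem pdPow_fdiff {f : Rn n → B} (hf : ContDiff ℝ ∞ f) (b : Fin n → ℕ) (i : Fin n) :
    pdPow b (fdiff i f) = fdiff i (pdPow b f) :=
  (multiIter_intertwine (S := {f : Rn n → B | ContDiff ℝ ∞ f}) (fun j _ h => contDiff_pd h j)
    (fun j _ h => (pd_fdiff h i j).symm) b hf).symm

theorem pdPow_sub {f g : Rn n → B} (hf : ContDiff ℝ ∞ f) (hg : ContDiff ℝ ∞ g)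
    (b : Fin n → ℕ) : pdPow b (f - g) = pdPow b f - pdPow b g := by
  induction b using multiOrder_induction with
  | zero => simp [pdPow_zero]
  | add_single b i ih =>
    rw [← pd_pdPow (f := f - g) (hf.sub hg), ih, pd_sub (contDiff_pdPow hf b) (contDiff_pdPow hg b),
      pd_pdPow hf, pd_pdPow hg]

theorem SymbolBounds.fdiff {μ : ℝ} {f : Rn n → B} (h : SymbolBounds μ f)
    (hf : ContDiff ℝ ∞ f) (i : Fin n) : SymbolBounds (μ - 1) (fdiff i f) := by
  intro b
  rw [pdPow_fdiff hf, sub_right_comm]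
  exact fdiff_isBigO_weight (contDiff_pdPow hf b) (h.pd_pdPow hf b) i

theorem SymbolBounds.pdPow_fdiff_sub_pd {μ : ℝ} {f : Rn n → B} (h : SymbolBounds μ f)
    (hf : ContDiff ℝ ∞ f) (b : Fin n → ℕ) (i : Fin n) :
    pdPow b (_root_.fdiff i f - pd i f) =O[⊤] weight (μ - mdeg b - 1 - 1) := by
  rw [pdPow_sub (contDiff_fdiff hf i) (contDiff_pd hf i), pdPow_fdiff hf,
    ← pdPow_add_single hf, ← _root_.pd_pdPow hf]
  refine fdiff_sub_pd_isBigO_weight (contDiff_pdPow hf b) (fun j k => ?_) i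
  have := h.pd_pdPow hf (b + Pi.single k 1) j
  rwa [← _root_.pd_pdPow hf, mdeg_add_single, Nat.cast_add_one, ← sub_sub] at this

omit [NormedAlgebra ℂ B] in
theorem fdiffPow_add_single (f : Rn n → B) (b : Fin n → ℕ) (i : Fin n) :
    fdiffPow (b + Pi.single i 1) f = fdiffPow b (fdiff i f) := by
  refine multiIter_add_single (S := Set.univ) (fun _ _ _ => trivial) (fun i j g _ => ?_) b i trivial
  ext ξ
  simp only [fdiff, add_right_comm ξ]
  abel

theorem SymbolBounds.fdiffPow_sub_pdPow (b : Fin n → ℕ) {μ : ℝ} {f : Rn n → B}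
    (h : SymbolBounds μ f) (hf : ContDiff ℝ ∞ f) :
    (fdiffPow b f - pdPow b f) =O[⊤] weight (μ - mdeg b - 1) := by
  induction b using multiOrder_induction generalizing μ f with
  | zero =>
    have h0 : fdiffPow 0 f = f := multiIter_zero _ f
    rw [h0, pdPow_zero, sub_self]
    exact isBigO_zero _ _
  | add_single b i ih =>
    have e : μ - (mdeg (b + Pi.single i 1) : ℝ) - 1 = μ - 1 - mdeg b - 1 := by
      rw [mdeg_add_single]; push_cast; ring
    have e' : μ - mdeg b - 1 - 1 = μ - 1 - mdeg b - 1 := by ring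
    have h1 := ih (h.fdiff hf i) (contDiff_fdiff hf i)
    have h2 := h.pdPow_fdiff_sub_pd hf b i
    rw [pdPow_sub (contDiff_fdiff hf i) (contDiff_pd hf i), e'] at h2
    rw [e, fdiffPow_add_single, pdPow_add_single hf]
    simpa using h1.add h2

theorem norm_sub_zEmb_floor_le (ξ : Rn n) : ‖ξ - zEmb fun j => ⌊ξ j⌋‖ ≤ √n := by
  rw [EuclideanSpace.norm_eq]
  refine Real.sqrt_le_sqrt ?_
  calc _ ≤ ∑ _j : Fin n, (1 : ℝ) := Finset.sum_le_sum fun j _ => ?_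
    _ = n := by simp
  have : (ξ - zEmb fun j => ⌊ξ j⌋) j = Int.fract (ξ j) := rfl
  rw [this, sq_le_one_iff₀ (norm_nonneg _), Real.norm_of_nonneg (Int.fract_nonneg _)]
  exact (Int.fract_lt_one _).le

/-- Comparing derivatives with finite differences at lattice points improves the order of a
symbol by one, as long as the lattice bounds allow it. -/
theorem SymbolBounds.improve {μ m : ℝ} {f : Rn n → B} (h : SymbolBounds μ f)
    (hf : ContDiff ℝ ∞ f)
    (hZ : ∀ b, (fun k : Fin n → ℤ => fdiffPow b f (zEmb k)) =O[⊤]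
      fun k => weight (m - mdeg b) (zEmb k)) :
    SymbolBounds (max m (μ - 1)) f := by
  intro b
  let κ : Rn n → Fin n → ℤ := fun ξ j => ⌊ξ j⌋
  have hκ : ∀ ν : ℝ, (fun ξ => weight ν (zEmb (κ ξ))) =O[⊤] (weight ν : Rn n → ℝ) := fun ν => by
    refine isBigO_top.2 ⟨(1 + √n) ^ |ν|, fun ξ => ?_⟩
    rw [norm_weight, norm_weight]
    exact weight_le_of_norm_sub_le (by rw [norm_sub_rev]; exact norm_sub_zEmb_floor_le ξ) ν
  have hloc : (fun ξ => pdPow b f (zEmb (κ ξ)) - pdPow b f ξ) =O[⊤]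
      weight (μ - mdeg b - 1) := by
    obtain ⟨C, hC⟩ := exists_norm_sub_le_weight (contDiff_pdPow hf b) (h.pd_pdPow hf b) √n
    refine isBigO_top.2 ⟨C, fun ξ => ?_⟩
    rw [norm_weight]
    exact hC _ _ (by rw [norm_sub_rev]; exact norm_sub_zEmb_floor_le ξ)
  have hdiff : (fun ξ => (fdiffPow b f - pdPow b f) (zEmb (κ ξ))) =O[⊤]
      (weight (μ - mdeg b - 1) : Rn n → ℝ) :=
    ((h.fdiffPow_sub_pdPow b hf).comp_tendsto (k := fun ξ => zEmb (κ ξ)) tendsto_top).trans (hκ _)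
  have hlat : (fun ξ => fdiffPow b f (zEmb (κ ξ))) =O[⊤] (weight (m - mdeg b) : Rn n → ℝ) :=
    ((hZ b).comp_tendsto (k := κ) tendsto_top).trans (hκ _)
  have hle : μ - mdeg b - 1 ≤ max m (μ - 1) - mdeg b := by
    linarith [le_max_right m (μ - 1)]
  have hle' : m - mdeg b ≤ max m (μ - 1) - mdeg b := by
    linarith [le_max_left m (μ - 1)]
  have hsum := ((hlat.trans (weight_isBigO_weight hle')).sub
    (hdiff.trans (weight_isBigO_weight hle))).sub (hloc.trans (weight_isBigO_weight hle))
  simpa using hsum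

theorem SymbolBounds.of_lattice {μ m : ℝ} {f : Rn n → B} (h : SymbolBounds μ f)
    (hf : ContDiff ℝ ∞ f)
    (hZ : ∀ b, (fun k : Fin n → ℤ => fdiffPow b f (zEmb k)) =O[⊤]
      fun k => weight (m - mdeg b) (zEmb k)) :
    SymbolBounds m f := by
  have key : ∀ N : ℕ, SymbolBounds (max m (μ - N)) f := by
    intro N
    induction N with
    | zero => exact h.mono (by simp)
    | succ N ih =>
      refine (ih.improve hf hZ).mono (max_le (le_max_left _ _) ?_)
      rw [sub_le_iff_le_add]
      refine max_le ?_ ?_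
      · linarith [le_max_left m (μ - ((N + 1 : ℕ) : ℝ))]
      · have := le_max_right m (μ - ((N + 1 : ℕ) : ℝ))
        push_cast at this ⊢
        linarith
  refine (key ⌈μ - m⌉₊).mono (max_le le_rfl ?_)
  linarith [Nat.le_ceil (μ - m)]

omit [NormedAlgebra ℂ B] in
theorem zdiffPow_comp_zEmb (f : Rn n → B) (b : Fin n → ℕ) (k : Fin n → ℤ) :
    zdiffPow b (fun p => f (zEmb p)) k = fdiffPow b f (zEmb k) := by
  refine (congrFun (multiIter_intertwine (S := Set.univ) (φ := fun (f : Rn n → B) p => f (zEmb p))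
    (T := fdiff) (U := zdiff) (fun _ _ _ => trivial) (fun j g _ => ?_) b trivial) k).symm
  ext p
  have : zEmb (p + Pi.single j 1) = zEmb p + EuclideanSpace.single j (1 : ℝ) := by
    ext i
    simp [zEmb, Pi.single_apply]
  simp [fdiff, zdiff, this]

theorem znorm_eq_norm_zEmb (k : Fin n → ℤ) : znorm k = ‖zEmb k‖ := by
  simp [znorm, zEmb, EuclideanSpace.norm_eq]

end SymbolBounds

/-- if `ρ ∈ 𝕊^μ(ℝⁿ;𝒜_θ)` for some `μ ∈ ℝ` and its restriction `(ρ(k))_{k∈ℤⁿ}`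
belongs to the toroidal class `𝕊^m(ℤⁿ;𝒜_θ)`, then `ρ ∈ 𝕊^m(ℝⁿ;𝒜_θ)`. -/
theorem statement_18
    {n : ℕ} (hn : 2 ≤ n)
    {A : Type} [NormedRing A] [StarRing A] [CStarRing A] [NormedAlgebra ℂ A]
    [StarModule ℂ A] [CompleteSpace A]
    (αa : Rn n → (A ≃⋆ₐ[ℂ] A))
    (hαadd : ∀ s t (u : A), αa (s + t) u = αa s (αa t u))
    (hα0 : ∀ u : A, αa 0 u = u)
    (hαiso : ∀ s (u : A), ‖αa s u‖ = ‖u‖)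
    (μ m : ℝ) (ρ : Rn n → A)
    (hρ : IsSymbol αa μ ρ)
    (hρZ : IsToroidal αa m (fun k => ρ (zEmb k))) :
    IsSymbol αa m ρ := by
  obtain ⟨hmem, hsm, hbd⟩ := hρ
  have hsm' : ∀ a, ContDiff ℝ ∞ fun ξ => δpow αa a (ρ ξ) := fun a => contDiff_infty.2 (hsm a)
  have hδ := fun a b => (pdPow_mem_smoothSet_and_δpow_pdPow hαadd hα0 hαiso hmem hsm' b).2 a
  refine ⟨hmem, hsm, fun a => ?_⟩
  have hμ : SymbolBounds μ fun ξ => δpow αa a (ρ ξ) := fun b => by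
    simpa only [isBigO_top_weight_iff, hδ] using hbd a b
  have hm : SymbolBounds m fun ξ => δpow αa a (ρ ξ) := by
    refine hμ.of_lattice (hsm' a) fun b => ?_
    obtain ⟨C, -, hC⟩ := hρZ.2 a b
    refine Asymptotics.isBigO_top.2 ⟨C, fun k => ?_⟩
    rw [norm_weight, ← zdiffPow_comp_zEmb, ← δpow_zdiffPow hαadd hαiso (fun k => hmem (zEmb k))]
    simpa only [znorm_eq_norm_zEmb, weight] using hC k
  intro b
  simpa only [isBigO_top_weight_iff, hδ] using hm b
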